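/- Let β ∈ (0, 1/2^{|S|}) and ε ∈ (0, β(1−β)/(L·|S|⁴)). Let q be an irreducible transition matrix on S with stationary distribution μ, and let q̂ be a transition matrix that is (ε,β)-close to q (so q̂ is irreducible, with stationary distribution μ̂). For a nonempty proper subset C of S, define K_C = μ_C / (Σ_{s∈C} μ_s q(C̄|s)) and K̂_C = μ̂_C / (Σ_{s∈C} μ̂_s q̂(C̄|s)) (these equal the long-run average lengths of visits to C under q and q̂ respectively). Then K_C/(2|S|²) ≤ K̂_C ≤ 2|S|²·K_C. -/

import Mathlib

open Finset

namespace PerturbedMC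

variable {S : Type*} [Fintype S] [DecidableEq S]

/-- `q` is a (row-stochastic) transition matrix on `S`: `q s t` is the probability of moving
from `s` to `t`. -/
def IsTransition (q : Matrix S S ℝ) : Prop :=
  (∀ s t, 0 ≤ q s t) ∧ ∀ s, ∑ t, q s t = 1

/-- `q` is irreducible. -/
def IsIrreducible (q : Matrix S S ℝ) : Prop :=
  ∀ s t, ∃ n : ℕ, 1 ≤ n ∧ 0 < (q ^ n) s t

/-- `μ` is a stationary distribution of `q`. -/
def IsStationary (q : Matrix S S ℝ) (μ : S → ℝ) : Prop :=
  (∀ s, 0 ≤ μ s) ∧ (∑ s, μ s = 1) ∧ ∀ t, ∑ s, μ s * q s t = μ t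

/-- The combinatorial constant `L = ∑_{n=1}^{|S|-1} C(|S|,n) · n^{|S|}`. -/
def Lconst (S : Type*) [Fintype S] : ℕ :=
  ∑ n ∈ Finset.Ico 1 (Fintype.card S), (Fintype.card S).choose n * n ^ Fintype.card S

/-- `ζ_q`: the minimal stationary outflow over nonempty proper subsets of `S`. -/
noncomputable def zeta (q : Matrix S S ℝ) (μ : S → ℝ) : ℝ :=
  sInf {x : ℝ | ∃ C : Finset S, C.Nonempty ∧ C ≠ Finset.univ ∧
    x = ∑ s ∈ C, μ s * ∑ t ∈ Cᶜ, q s t}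

/-- `ζ_q^1`: the minimal stationary outflow over nonempty proper subsets of `S₁`. -/
noncomputable def zeta1 (q : Matrix S S ℝ) (μ : S → ℝ) (S1 : Finset S) : ℝ :=
  sInf {x : ℝ | ∃ C : Finset S, C.Nonempty ∧ C ⊂ S1 ∧
    x = ∑ s ∈ C, μ s * ∑ t ∈ Cᶜ, q s t}

/-- `q̂` is `(ε,β)`-close to `q`, relative to the threshold `z` (`z = ζ_q` or `z = ζ_q^1`):
`|q̂(t|s) − q(t|s)| ≤ β·q(t|s)` whenever `μ_s q(t|s) ≥ ε·z` or `μ_s q̂(t|s) ≥ ε·z`. -/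
def IsClose (q qh : Matrix S S ℝ) (μ : S → ℝ) (z ε β : ℝ) : Prop :=
  ∀ s t, (ε * z ≤ μ s * q s t ∨ ε * z ≤ μ s * qh s t) → |qh s t - q s t| ≤ β * q s t

/-- The substochastic `C × C` restriction `q_C` of `q`. -/
def subMat (q : Matrix S S ℝ) (C : Finset S) : Matrix S S ℝ :=
  fun u v => if u ∈ C ∧ v ∈ C then q u v else 0

/-- The exit distribution `Q_{s,q}(t|C) = Σ_{n≥0} Σ_{u∈C} (q_C^n)(u|s)·q(t|u)`. -/
noncomputable def exitProb (q : Matrix S S ℝ) (C : Finset S) (s t : S) : ℝ :=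
  ∑' n : ℕ, ∑ u ∈ C, ((subMat q C ^ n : Matrix S S ℝ) s u) * q u t

/-- The expected exit time `E_{s,q}[T_{C̄}] = Σ_{n≥0} Σ_{u∈C} (q_C^n)(u|s) ∈ [0,∞]`. -/
noncomputable def expExit (q : Matrix S S ℝ) (C : Finset S) (s : S) : ENNReal :=
  ∑' n : ℕ, ENNReal.ofReal (∑ u ∈ C, (subMat q C ^ n : Matrix S S ℝ) s u)

/-- `g` has a cycle within `C`. -/
def HasCycle (C : Finset S) (g : S → S) : Prop :=
  ∃ (k : ℕ) (f : ℕ → S), 0 < k ∧ f k = f 0 ∧ (∀ i < k, f i ∈ C) ∧ ∀ i < k, g (f i) = f (i + 1)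

/-- `g` is a `C`-graph (the values of `g` outside `C` are irrelevant). -/
def IsCGraph (C : Finset S) (g : S → S) : Prop := ¬ HasCycle C g

/-- `s` leads to `t` along `g`: `t` is the first state outside `C` on the `g`-orbit of `s`. -/
def LeadsTo (C : Finset S) (g : S → S) (s t : S) : Prop :=
  ∃ n : ℕ, g^[n] s = t ∧ t ∉ C ∧ ∀ m < n, g^[m] s ∈ C

/-- The weight `p(g) = Π_{s∈C} q(g(s)|s)` of a `C`-graph under `q`. -/
def wt (q : Matrix S S ℝ) (C : Finset S) (g : S → S) : ℝ := ∏ s ∈ C, q s (g s)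

/-- `G(C)`: the canonical representatives of `C`-graphs, namely the maps `S → S` that are
`C`-graphs and are the identity outside `C`. -/
noncomputable def Gset (C : Finset S) : Finset (S → S) :=
  @Finset.filter _ (fun g => IsCGraph C g ∧ ∀ s ∉ C, g s = s) (Classical.decPred _) Finset.univ

/-- `G_{s,t}(C)`: the `C`-graphs along which `s` leads to `t`. -/
noncomputable def GsetLead (C : Finset S) (s t : S) : Finset (S → S) :=
  @Finset.filter _ (fun g => LeadsTo C g s t) (Classical.decPred _) (Gset C)

/-- `g` is an `η`-maximal `C`-graph under `q`: `p(g) ≥ η · max_{g' ∈ G(C)} p(g')`. -/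
def IsMaximal (q : Matrix S S ℝ) (C : Finset S) (η : ℝ) (g : S → S) : Prop :=
  IsCGraph C g ∧ ∀ g', IsCGraph C g' → η * wt q C g' ≤ wt q C g

/-- `H = G^β(C) ∪ Ĝ^β(C)` as a finset of canonical representatives. -/
noncomputable def Hset (q qh : Matrix S S ℝ) (C : Finset S) (β : ℝ) : Finset (S → S) :=
  @Finset.filter _ (fun g => IsMaximal q C β g ∨ IsMaximal qh C β g)
    (Classical.decPred _) (Gset C)

/-- The mixing hypothesis with parameter `a` on `S₁`: for all `s,t ∈ S₁`, the probability
that the chain started at `s`, from its first step onward, reaches `t` before reaching any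
state of `S \ S₁`, is at least `a`. -/
def Mixing (q : Matrix S S ℝ) (S1 : Finset S) (a : ℝ) : Prop :=
  ∀ s ∈ S1, ∀ t ∈ S1,
    a ≤ q s t + ∑ u ∈ S1.erase t, q s u * exitProb q (S1.erase t) u t

/-- `R` is a recurrent class for `q`. -/
def IsRecClass (q : Matrix S S ℝ) (R : Finset S) : Prop :=
  (∀ s ∈ R, ∑ t ∈ Rᶜ, q s t = 0) ∧
    ∀ s ∈ R, ∀ t ∈ R, ∃ n : ℕ, 1 ≤ n ∧ 0 < (q ^ n) s t

/-! ### The rooted-forest expansion of principal cofactors of a Laplacian -/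

/-- A real matrix with weakly dominant nonnegative diagonal has nonnegative determinant. -/
theorem det_nonneg_of_sum_row_le_diag (A : Matrix S S ℝ)
    (h : ∀ i, ∑ j ∈ univ.erase i, |A i j| ≤ A i i) : 0 ≤ A.det := by
  by_contra! hneg
  let f : ℝ → ℝ := fun t => ((1 - t) • (1 : Matrix S S ℝ) + t • A).det
  have hf : Continuous f := by
    apply Continuous.matrix_det
    fun_prop
  have h0 : f 0 = 1 := by simp [f]
  have h1 : f 1 = A.det := by simp [f]
  obtain ⟨t, ht, hft⟩ : ∃ t ∈ Set.Icc (0 : ℝ) 1, f t = 0 := by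
    have := intermediate_value_Icc' (zero_le_one' ℝ) hf.continuousOn
    exact this ⟨by rw [h1]; exact hneg.le, by rw [h0]; exact zero_le_one⟩
  have ht1 : t < 1 := by
    refine lt_of_le_of_ne ht.2 ?_
    rintro rfl
    linarith
  refine det_ne_zero_of_sum_row_lt_diag (fun i => ?_) hft
  have hs : ∑ j ∈ univ.erase i, ‖((1 - t) • (1 : Matrix S S ℝ) + t • A) i j‖
      = t * ∑ j ∈ univ.erase i, |A i j| := by
    rw [Finset.mul_sum]
    refine Finset.sum_congr rfl fun j hj => ?_
    have : i ≠ j := (Finset.ne_of_mem_erase hj).symm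
    simp [Matrix.one_apply_ne this, abs_of_nonneg ht.1]
  rw [hs]
  have hd : ((1 - t) • (1 : Matrix S S ℝ) + t • A) i i = (1 - t) + t * A i i := by simp
  rw [hd]
  refine lt_of_lt_of_le ?_ (le_abs_self _)
  have := mul_le_mul_of_nonneg_left (h i) ht.1
  linarith

/-- The row attached to the arrow `s → t` in the Laplacian with root `r`. -/
def arrowRow (r s t : S) : S → ℝ :=
  if s = r then Pi.single r 1 else Pi.single s 1 - Pi.single t 1

/-- The matrix whose rows combine the arrow rows with coefficients `B`. -/
def arrowMat (r : S) (B : Matrix S S ℝ) : Matrix S S ℝ :=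
  fun s => ∑ t, B s t • arrowRow r s t

theorem det_arrowMat (r : S) (B : Matrix S S ℝ) :
    (arrowMat r B).det = ∑ g : S → S, (∏ s, B s (g s)) *
      Matrix.det (fun s => arrowRow r s (g s) : Matrix S S ℝ) := by
  have h := MultilinearMap.map_sum (Matrix.detRowAlternating (R := ℝ) (n := S)).toMultilinearMap
    (fun s t => B s t • arrowRow r s t)
  refine h.trans (Finset.sum_congr rfl fun g _ => ?_)
  exact MultilinearMap.map_smul_univ
    (Matrix.detRowAlternating (R := ℝ) (n := S)).toMultilinearMap
    (fun s => B s (g s)) (fun s => arrowRow r s (g s))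

theorem det_arrowRow_nonneg (r : S) (g : S → S) :
    0 ≤ Matrix.det (fun s => arrowRow r s (g s) : Matrix S S ℝ) := by
  refine det_nonneg_of_sum_row_le_diag _ fun i => ?_
  by_cases hi : i = r
  · subst hi
    refine (Finset.sum_nonpos fun j hj => ?_).trans ?_
    · simp [arrowRow, Finset.ne_of_mem_erase hj]
    · simp [arrowRow]
  · have hoff : ∀ j ∈ univ.erase i, |arrowRow r i (g i) j| = if g i = j then 1 else 0 := by
      intro j hj
      have hj' : j ≠ i := Finset.ne_of_mem_erase hj
      by_cases hg : g i = j
      · simp [arrowRow, hi, hj', hg]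
      · simp [arrowRow, hi, hj', hg, Ne.symm hg]
    rw [Finset.sum_congr rfl hoff, Finset.sum_ite_eq]
    by_cases hg : g i = i
    · simp [arrowRow, hi, hg]
    · simp [arrowRow, hi, hg, Ne.symm hg]

theorem det_arrowMat_nonneg (r : S) {B : Matrix S S ℝ} (hB : ∀ s t, 0 ≤ B s t) :
    0 ≤ (arrowMat r B).det := by
  rw [det_arrowMat]
  exact Finset.sum_nonneg fun g _ =>
    mul_nonneg (Finset.prod_nonneg fun s _ => hB s _) (det_arrowRow_nonneg r g)

theorem pow_mul_det_arrowMat_le (r : S) {a : ℝ} (ha : 0 ≤ a) {B B' : Matrix S S ℝ}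
    (hB : ∀ s t, 0 ≤ B s t) (h : ∀ s t, a * B s t ≤ B' s t) :
    a ^ Fintype.card S * (arrowMat r B).det ≤ (arrowMat r B').det := by
  rw [det_arrowMat, det_arrowMat, Finset.mul_sum]
  refine Finset.sum_le_sum fun g _ => ?_
  rw [← mul_assoc]
  refine mul_le_mul_of_nonneg_right ?_ (det_arrowRow_nonneg r g)
  calc a ^ Fintype.card S * ∏ s, B s (g s) = ∏ s, a * B s (g s) := by
        rw [Finset.prod_mul_distrib, Finset.prod_const, Finset.card_univ]
    _ ≤ ∏ s, B' s (g s) :=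
        Finset.prod_le_prod (fun s _ => mul_nonneg ha (hB s _)) fun s _ => h s _

theorem prod_sub_sum_update_le {ι : Type*} [DecidableEq ι] (A : Finset ι) (b d : ι → ℝ)
    (hd : ∀ s, 0 ≤ d s)
    (hdb : ∀ s, d s ≤ b s) :
    ∏ s ∈ A, b s - ∑ s ∈ A, ∏ u ∈ A, Function.update b s (d s) u ≤ ∏ s ∈ A, (b s - d s) := by
  induction A using Finset.induction_on with
  | empty => simp
  | insert a A ha ih =>
    have h1 : ∏ u ∈ A, Function.update b a (d a) u = ∏ u ∈ A, b u :=
      Finset.prod_congr rfl fun u hu => Function.update_of_ne (by rintro rfl; exact ha hu) _ _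
    have h2 : ∑ s ∈ A, ∏ u ∈ insert a A, Function.update b s (d s) u
        = b a * ∑ s ∈ A, ∏ u ∈ A, Function.update b s (d s) u := by
      rw [Finset.mul_sum]
      refine Finset.sum_congr rfl fun s hs => ?_
      rw [Finset.prod_insert ha, Function.update_of_ne (by rintro rfl; exact ha hs)]
    have h3 : ∏ s ∈ A, (b s - d s) ≤ ∏ s ∈ A, b s :=
      Finset.prod_le_prod (fun s _ => sub_nonneg.2 (hdb s)) fun s _ => by linarith [hd s]
    rw [Finset.prod_insert ha, Finset.prod_insert ha, Finset.sum_insert ha, h2,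
      Finset.prod_insert ha, h1, Function.update_self]
    have h4 := mul_le_mul_of_nonneg_left ih ((hd a).trans (hdb a))
    have h5 := mul_le_mul_of_nonneg_left h3 (hd a)
    linarith

theorem det_arrowMat_sub_le (r : S) {B D : Matrix S S ℝ} (hD : ∀ s t, 0 ≤ D s t)
    (hDB : ∀ s t, D s t ≤ B s t) :
    (arrowMat r B).det - ∑ s, ((arrowMat r B).updateRow s (∑ t, D s t • arrowRow r s t)).det
      ≤ (arrowMat r (B - D)).det := by
  have hupd : ∀ s, (arrowMat r B).updateRow s (∑ t, D s t • arrowRow r s t)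
      = arrowMat r (B.updateRow s (D s)) := by
    intro s
    funext u
    by_cases hu : u = s
    · subst hu; simp [arrowMat]
    · simp [arrowMat, hu]
  simp_rw [hupd, det_arrowMat]
  rw [Finset.sum_comm, ← Finset.sum_sub_distrib]
  refine Finset.sum_le_sum fun g _ => ?_
  rw [← Finset.sum_mul, ← sub_mul]
  refine mul_le_mul_of_nonneg_right ?_ (det_arrowRow_nonneg r g)
  have := prod_sub_sum_update_le univ (fun s => B s (g s)) (fun s => D s (g s))
    (fun s => hD s _) (fun s => hDB s _)
  have hu : ∀ s u, B.updateRow s (D s) u (g u)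
      = Function.update (fun s => B s (g s)) s (D s (g s)) u := by
    intro s u
    by_cases hu : u = s
    · subst hu; simp
    · simp [hu]
  simpa only [hu, Matrix.sub_apply] using this

/-! ### Laplacians -/

/-- The Laplacian of a matrix of transition rates; the diagonal of `p` is irrelevant. -/
def lap (p : Matrix S S ℝ) : Matrix S S ℝ := Matrix.diagonal (fun s => ∑ t, p s t) - p

/-- The principal cofactor of the Laplacian at `r`; by the matrix-tree theorem this is the
total weight of the spanning trees rooted at `r`. -/
def treeWt (r : S) (p : Matrix S S ℝ) : ℝ := ((lap p).updateRow r (Pi.single r 1)).det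

/-- Replace the row of the root by a point mass at the root. -/
def rootRow (r : S) (p : Matrix S S ℝ) : Matrix S S ℝ := p.updateRow r (Pi.single r 1)

theorem lap_mulVec (p : Matrix S S ℝ) (x : S → ℝ) (u : S) :
    (lap p).mulVec x u = ∑ w, p u w * (x u - x w) := by
  rw [lap, Matrix.sub_mulVec, Pi.sub_apply, Matrix.mulVec_diagonal, Finset.sum_mul]
  simp [Matrix.mulVec, dotProduct, mul_sub, Finset.sum_sub_distrib]

theorem arrowMat_rootRow (r : S) (p : Matrix S S ℝ) :
    arrowMat r (rootRow r p) = (lap p).updateRow r (Pi.single r 1) := by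
  funext s
  by_cases hs : s = r
  · subst hs
    simp [arrowMat, rootRow, arrowRow, Pi.single_apply]
  · funext u
    simp [arrowMat, rootRow, arrowRow, hs, lap, Matrix.diagonal_apply, Pi.single_apply,
      mul_sub, Finset.sum_sub_distrib, eq_comm]

theorem treeWt_eq (r : S) (p : Matrix S S ℝ) : treeWt r p = (arrowMat r (rootRow r p)).det := by
  rw [arrowMat_rootRow, treeWt]

theorem rootRow_nonneg {ι : Type*} [DecidableEq ι] (r : ι) {p : Matrix ι ι ℝ}
    (hp : ∀ s t, 0 ≤ p s t) (s t : ι) :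
    0 ≤ rootRow r p s t := by
  by_cases hs : s = r
  · subst hs
    by_cases ht : t = s <;> simp [rootRow, ht]
  · simpa [rootRow, hs] using hp s t

theorem treeWt_nonneg (r : S) {p : Matrix S S ℝ} (hp : ∀ s t, 0 ≤ p s t) : 0 ≤ treeWt r p := by
  rw [treeWt_eq]
  exact det_arrowMat_nonneg r (rootRow_nonneg r hp)

theorem pow_mul_treeWt_le (r : S) {a : ℝ} (ha : 0 ≤ a) (ha1 : a ≤ 1) {p p' : Matrix S S ℝ}
    (hp : ∀ s t, 0 ≤ p s t) (h : ∀ s t, a * p s t ≤ p' s t) :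
    a ^ Fintype.card S * treeWt r p ≤ treeWt r p' := by
  rw [treeWt_eq, treeWt_eq]
  refine pow_mul_det_arrowMat_le r ha (rootRow_nonneg r hp) fun s t => ?_
  by_cases hs : s = r
  · subst hs
    by_cases ht : t = s <;> simp [rootRow, ht, ha1]
  · simpa [rootRow, hs] using h s t

/-- The weights `treeWt j p` form a left null vector of the Laplacian. -/
theorem sum_treeWt_mul_lap (p : Matrix S S ℝ) (t : S) : ∑ j, treeWt j p * lap p j t = 0 := by
  have hker : ∀ M : Matrix S S ℝ, M.mulVec (fun _ => 1) = 0 → M.det = 0 := fun M hM =>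
    Matrix.exists_mulVec_eq_zero_iff.1 ⟨_, fun h => one_ne_zero (congrFun h t), hM⟩
  have hlap : (lap p).mulVec (fun _ => 1) = 0 := by
    funext u; rw [lap_mulVec]; simp
  have hadj : ∀ i j, (lap p).adjugate i j = treeWt j p := by
    intro i j
    have h0 : ((lap p).updateRow j (Pi.single i 1 - Pi.single j 1)).det = 0 := by
      apply hker
      funext u
      by_cases hu : u = j
      · subst hu
        simp [Matrix.mulVec, dotProduct]
      · simpa [Matrix.mulVec, hu] using congrFun hlap u
    have h1 := Matrix.det_updateRow_add (lap p) j (Pi.single i 1 - Pi.single j 1) (Pi.single j 1)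
    rw [sub_add_cancel, h0, zero_add] at h1
    rw [Matrix.adjugate_apply, h1, treeWt]
  have h := congrFun (congrFun (Matrix.adjugate_mul (lap p)) t) t
  rw [hker _ hlap, zero_smul, Matrix.mul_apply] at h
  simpa [hadj] using h

/-- Left null vectors of a Laplacian are proportional to the tree weights. -/
theorem mul_treeWt_comm {p : Matrix S S ℝ} {r : S} (hr : treeWt r p ≠ 0) {ν : S → ℝ}
    (hν : ∀ t, ∑ s, ν s * lap p s t = 0) (s : S) :
    ν s * treeWt r p = ν r * treeWt s p := by
  let y : S → ℝ := fun s => ν s * treeWt r p - ν r * treeWt s p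
  have hyr : y r = 0 := sub_self _
  have hy : ∀ t, ∑ s, y s * lap p s t = 0 := by
    intro t
    have : ∀ s, y s * lap p s t
        = treeWt r p * (ν s * lap p s t) - ν r * (treeWt s p * lap p s t) := by
      intro s; simp only [y]; ring
    simp_rw [this]
    rw [Finset.sum_sub_distrib, ← Finset.mul_sum, ← Finset.mul_sum, hν, sum_treeWt_mul_lap]
    simp
  have h0 : y = 0 := by
    refine Matrix.eq_zero_of_vecMul_eq_zero hr ?_
    funext t
    rw [Pi.zero_apply, ← hy t]
    refine Finset.sum_congr rfl fun s _ => ?_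
    by_cases hs : s = r
    · subst hs; simp [hyr]
    · simp [hs]
  exact sub_eq_zero.1 (congrFun h0 s)

/-! ### Cuts -/

theorem cut_flow_eq {f : S → S → ℝ} (hbal : ∀ u, ∑ w, f u w = ∑ w, f w u) (C : Finset S)
    (x : S → ℝ) :
    ∑ u ∈ C, ∑ w, f u w * (x u - x w)
      = ∑ u ∈ C, ∑ w ∈ Cᶜ, f w u * x u - ∑ u ∈ C, ∑ w ∈ Cᶜ, f u w * x w := by
  have h1 : ∀ u, ∑ w ∈ C, f u w + ∑ w ∈ Cᶜ, f u w = ∑ w ∈ C, f w u + ∑ w ∈ Cᶜ, f w u := by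
    intro u
    rw [Finset.sum_add_sum_compl, Finset.sum_add_sum_compl, hbal]
  have h2 : ∑ u ∈ C, ∑ w ∈ C, f u w * x w = ∑ u ∈ C, ∑ w ∈ C, f w u * x u := Finset.sum_comm
  have h3 : ∀ u, ∑ w, f u w * (x u - x w) = (∑ w ∈ C, f w u * x u - ∑ w ∈ C, f u w * x w)
      + (∑ w ∈ Cᶜ, f w u * x u - ∑ w ∈ Cᶜ, f u w * x w) := by
    intro u
    have e : ∑ w, f u w * x w = ∑ w ∈ C, f u w * x w + ∑ w ∈ Cᶜ, f u w * x w :=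
      (Finset.sum_add_sum_compl C _).symm
    simp_rw [mul_sub]
    rw [Finset.sum_sub_distrib, e, ← Finset.sum_mul, ← Finset.sum_mul, ← Finset.sum_mul, hbal,
      ← Finset.sum_add_sum_compl C (fun w => f w u)]
    ring
  simp_rw [h3]
  rw [Finset.sum_add_distrib, Finset.sum_sub_distrib, h2, sub_self, zero_add,
    Finset.sum_sub_distrib]

theorem exists_gap (x : S → ℝ) {s t : S} (h : x t < x s) :
    ∃ m, ∃ C : Finset S, s ∈ C ∧ t ∉ C ∧ (∀ u ∈ C, m + (x s - x t) / Fintype.card S ≤ x u) ∧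
      ∀ u ∉ C, x u ≤ m := by
  classical
  set N := Fintype.card S with hN
  have hN0 : 0 < (N : ℝ) := by exact_mod_cast Fintype.card_pos_iff.2 ⟨s⟩
  set δ := (x s - x t) / N with hδ
  have hδ0 : 0 < δ := div_pos (sub_pos.2 h) hN0
  have hNδ : N * δ = x s - x t := by rw [hδ]; field_simp
  obtain ⟨k, hk⟩ : ∃ k : Fin N, ∀ u, u ≠ s → x u < x t + k * δ ∨ x t + (k + 1) * δ ≤ x u := by
    by_contra! hcon
    choose φ hφs hφ1 hφ2 using hcon
    have hlt : ∀ i j : Fin N, i < j → φ i ≠ φ j := by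
      intro i j hij he
      have hij' : (i : ℝ) + 1 ≤ (j : ℝ) := by exact_mod_cast hij
      have h1 := hφ2 i
      have h2 := hφ1 j
      rw [he] at h1
      nlinarith
    have hinj : Function.Injective φ := by
      intro i j he
      rcases lt_trichotomy i j with hij | hij | hij
      · exact absurd he (hlt i j hij)
      · exact hij
      · exact absurd he.symm (hlt j i hij)
    have hbij : Function.Bijective φ :=
      (Fintype.bijective_iff_injective_and_card φ).2 ⟨hinj, by simp [hN]⟩
    obtain ⟨i, hi⟩ := hbij.2 s
    exact hφs i hi
  have hk1 : (k : ℝ) + 1 ≤ N := by exact_mod_cast k.2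
  have hk0 : (0 : ℝ) ≤ k := Nat.cast_nonneg _
  refine ⟨x t + k * δ, univ.filter fun u => x t + (k + 1) * δ ≤ x u, ?_, ?_, ?_, ?_⟩
  · simp only [mem_filter, mem_univ, true_and]
    nlinarith
  · simp only [mem_filter, mem_univ, true_and, not_le]
    nlinarith
  · intro u hu
    simp only [mem_filter, mem_univ, true_and] at hu
    linarith
  · intro u hu
    simp only [mem_filter, mem_univ, true_and, not_le] at hu
    have hus : u ≠ s := by
      rintro rfl
      nlinarith
    rcases hk u hus with h1 | h1
    · exact h1.le
    · linarith

/-- A potential drop from `s` to `t` forces a proportionate net flow across some cut. -/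
theorem exists_cut_flow {f : S → S → ℝ} (hf : ∀ u w, 0 ≤ f u w)
    (hbal : ∀ u, ∑ w, f u w = ∑ w, f w u) {z : ℝ}
    (hcut : ∀ C : Finset S, C.Nonempty → C ≠ univ → z ≤ ∑ u ∈ C, ∑ w ∈ Cᶜ, f u w)
    (x : S → ℝ) {s t : S} (h : x t < x s) :
    ∃ C : Finset S, s ∈ C ∧ t ∉ C ∧
      (x s - x t) * z ≤ Fintype.card S * ∑ u ∈ C, ∑ w, f u w * (x u - x w) := by
  obtain ⟨m, C, hs, ht, hC, hC'⟩ := exists_gap x h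
  refine ⟨C, hs, ht, ?_⟩
  have hN0 : 0 < (Fintype.card S : ℝ) := by exact_mod_cast Fintype.card_pos_iff.2 ⟨s⟩
  set δ := (x s - x t) / Fintype.card S with hδ
  have hδ0 : 0 < δ := div_pos (sub_pos.2 h) hN0
  have hNδ : x s - x t = Fintype.card S * δ := by rw [hδ]; field_simp
  have hout := hcut C ⟨s, hs⟩ (fun hu => ht (hu ▸ mem_univ t))
  have hio : ∑ u ∈ C, ∑ w ∈ Cᶜ, f w u = ∑ u ∈ C, ∑ w ∈ Cᶜ, f u w := by
    have := cut_flow_eq hbal C (fun _ => 1)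
    simp only [sub_self, mul_zero, mul_one, Finset.sum_const_zero] at this
    linarith
  rw [cut_flow_eq hbal, hNδ, mul_assoc]
  refine mul_le_mul_of_nonneg_left ?_ hN0.le
  have h1 : (m + δ) * ∑ u ∈ C, ∑ w ∈ Cᶜ, f w u ≤ ∑ u ∈ C, ∑ w ∈ Cᶜ, f w u * x u := by
    simp_rw [Finset.mul_sum]
    refine Finset.sum_le_sum fun u hu => Finset.sum_le_sum fun w _ => ?_
    rw [mul_comm]
    exact mul_le_mul_of_nonneg_left (hC u hu) (hf w u)
  have h2 : ∑ u ∈ C, ∑ w ∈ Cᶜ, f u w * x w ≤ m * ∑ u ∈ C, ∑ w ∈ Cᶜ, f u w := by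
    simp_rw [Finset.mul_sum]
    refine Finset.sum_le_sum fun u _ => Finset.sum_le_sum fun w hw => ?_
    rw [mul_comm m]
    exact mul_le_mul_of_nonneg_left (hC' w (Finset.mem_compl.1 hw)) (hf u w)
  rw [hio] at h1
  have h3 := mul_le_mul_of_nonneg_left hout hδ0.le
  linarith

/-- `p` is a matrix of rates, with the positive vector `μ` balanced for it, all of whose cuts
carry a flow of at least `z`. -/
structure HasCuts (p : Matrix S S ℝ) (μ : S → ℝ) (z : ℝ) : Prop where
  nonneg : ∀ s t, 0 ≤ p s t
  pos : ∀ s, 0 < μ s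
  balanced : ∀ u, ∑ w, μ u * p u w = ∑ w, μ w * p w u
  cut : ∀ C : Finset S, C.Nonempty → C ≠ univ → z ≤ ∑ u ∈ C, ∑ w ∈ Cᶜ, μ u * p u w

theorem HasCuts.exists_cut {p : Matrix S S ℝ} {μ : S → ℝ} {z : ℝ} (h : HasCuts p μ z)
    (x : S → ℝ) {s t : S} (hst : x t < x s) :
    ∃ C : Finset S, s ∈ C ∧ t ∉ C ∧
      (x s - x t) * z ≤ Fintype.card S * ∑ u ∈ C, μ u * (lap p).mulVec x u := by
  obtain ⟨C, hs, ht, hC⟩ := exists_cut_flow (f := fun u w => μ u * p u w)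
    (fun u w => mul_nonneg (h.pos u).le (h.nonneg u w)) h.balanced h.cut x hst
  refine ⟨C, hs, ht, hC.trans_eq ?_⟩
  simp_rw [lap_mulVec, Finset.mul_sum, mul_assoc]

theorem HasCuts.sum_mul_lap {p : Matrix S S ℝ} {μ : S → ℝ} {z : ℝ} (h : HasCuts p μ z) (t : S) :
    ∑ s, μ s * lap p s t = 0 := by
  simp only [lap, Matrix.sub_apply, Matrix.diagonal_apply, mul_sub, Finset.sum_sub_distrib,
    mul_ite, mul_zero, Finset.sum_ite_eq', mem_univ, if_true, Finset.mul_sum]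
  rw [h.balanced, sub_self]

theorem HasCuts.sum_mul_mulVec {p : Matrix S S ℝ} {μ : S → ℝ} {z : ℝ} (h : HasCuts p μ z)
    (x : S → ℝ) : ∑ u, μ u * (lap p).mulVec x u = 0 := by
  simp only [Matrix.mulVec, dotProduct, Finset.mul_sum]
  rw [Finset.sum_comm]
  refine Finset.sum_eq_zero fun t _ => ?_
  simp_rw [← mul_assoc]
  rw [← Finset.sum_mul, h.sum_mul_lap, zero_mul]

theorem updateRow_mulVec_of_ne (p : Matrix S S ℝ) (x : S → ℝ) {r u : S} (hu : u ≠ r) :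
    ((lap p).updateRow r (Pi.single r 1)).mulVec x u = (lap p).mulVec x u := by
  simp [Matrix.mulVec, hu]

theorem HasCuts.treeWt_pos {p : Matrix S S ℝ} {μ : S → ℝ} {z : ℝ} (h : HasCuts p μ z)
    (hz : 0 < z) (r : S) : 0 < treeWt r p := by
  refine lt_of_le_of_ne (treeWt_nonneg r h.nonneg) fun h0 => ?_
  obtain ⟨x, hx, hMx⟩ := Matrix.exists_mulVec_eq_zero_iff.2 h0.symm
  have hxr : x r = 0 := by simpa [Matrix.mulVec] using congrFun hMx r
  have hlap0 : ∀ u, u ≠ r → (lap p).mulVec x u = 0 := fun u hu => by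
    rw [← updateRow_mulVec_of_ne p x hu, hMx, Pi.zero_apply]
  have hlap : ∀ u, (lap p).mulVec x u = 0 := by
    intro u
    by_cases hu : u = r
    · subst hu
      have := h.sum_mul_mulVec x
      rw [Finset.sum_eq_single_of_mem u (mem_univ u)
        (fun v _ hv => by rw [hlap0 v hv, mul_zero])] at this
      exact (mul_eq_zero.1 this).resolve_left (h.pos u).ne'
    · exact hlap0 u hu
  have hle : ∀ s t, x s ≤ x t := by
    intro s t
    by_contra! hst
    obtain ⟨C, -, -, hC⟩ := h.exists_cut x hst
    simp only [hlap, mul_zero, Finset.sum_const_zero] at hC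
    exact absurd hC (not_le.2 (mul_pos (sub_pos.2 hst) hz))
  exact hx (funext fun s => (le_antisymm (hle s r) (hle r s)).trans hxr)

theorem HasCuts.adjugate_sub_le {p : Matrix S S ℝ} {μ : S → ℝ} {z : ℝ} (h : HasCuts p μ z)
    (hz : 0 ≤ z) {r s : S} (hs : s ≠ r) (t : S) :
    (((lap p).updateRow r (Pi.single r 1)).adjugate s s
      - ((lap p).updateRow r (Pi.single r 1)).adjugate t s) * z
      ≤ Fintype.card S * (μ s * treeWt r p) := by
  set M := (lap p).updateRow r (Pi.single r 1) with hM
  have hW := treeWt_nonneg r h.nonneg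
  have hrhs : 0 ≤ Fintype.card S * (μ s * treeWt r p) :=
    mul_nonneg (Nat.cast_nonneg _) (mul_nonneg (h.pos s).le hW)
  let x : S → ℝ := fun u => M.adjugate u s
  have hMx : ∀ u, M.mulVec x u = if u = s then treeWt r p else 0 := by
    intro u
    have := congrFun (congrFun (Matrix.mul_adjugate M) u) s
    rw [Matrix.mul_apply] at this
    rw [Matrix.mulVec, dotProduct, this]
    simp [Matrix.one_apply, treeWt, hM]
  have hlap : ∀ u, u ≠ r → (lap p).mulVec x u = if u = s then treeWt r p else 0 := fun u hu => by
    rw [← hMx, hM, updateRow_mulVec_of_ne p x hu]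
  have hr : μ r * (lap p).mulVec x r = -(μ s * treeWt r p) := by
    have h1 := h.sum_mul_mulVec x
    rw [← Finset.add_sum_erase _ _ (mem_univ r), Finset.sum_eq_single_of_mem s
      (Finset.mem_erase.2 ⟨hs, mem_univ s⟩)
      (fun u hu hus => by rw [hlap u (Finset.ne_of_mem_erase hu), if_neg hus, mul_zero]),
      hlap s hs, if_pos rfl] at h1
    linarith
  have hle : ∀ u, μ u * (lap p).mulVec x u ≤ if u = s then μ s * treeWt r p else 0 := by
    intro u
    by_cases hu : u = r
    · subst hu
      rw [hr, if_neg (Ne.symm hs)]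
      exact neg_nonpos.2 (mul_nonneg (h.pos s).le hW)
    · rw [hlap u hu]
      by_cases hus : u = s
      · subst hus; simp
      · simp [hus]
  rcases le_or_gt (x s) (x t) with hst | hst
  · exact (mul_nonpos_of_nonpos_of_nonneg (sub_nonpos.2 hst) hz).trans hrhs
  · obtain ⟨C, hsC, -, hC⟩ := h.exists_cut x hst
    refine hC.trans (mul_le_mul_of_nonneg_left ?_ (Nat.cast_nonneg _))
    refine (Finset.sum_le_sum fun u _ => hle u).trans_eq ?_
    rw [Finset.sum_ite_eq', if_pos hsC]

theorem rootRow_sub {ι : Type*} [DecidableEq ι] (r : ι) (p d : Matrix ι ι ℝ) :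
    rootRow r p - d.updateRow r 0 = rootRow r (p - d) := by
  funext s
  by_cases hs : s = r
  · subst hs; funext t; simp [rootRow]
  · funext t; simp [rootRow, hs]

/-- Removing rates that are small relative to the cuts changes the tree weights only slightly. -/
theorem HasCuts.treeWt_sub_ge {p : Matrix S S ℝ} {μ : S → ℝ} {z : ℝ} (h : HasCuts p μ z)
    (hz : 0 < z) {e : ℝ} (he : 0 ≤ e) {d : Matrix S S ℝ} (hd0 : ∀ s t, 0 ≤ d s t)
    (hdp : ∀ s t, d s t ≤ p s t) (hde : ∀ s t, μ s * d s t ≤ e * z) (r : S) :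
    (1 - e * (Fintype.card S : ℝ) ^ 3) * treeWt r p ≤ treeWt r (p - d) := by
  have hW := treeWt_nonneg r h.nonneg
  have hN : (0 : ℝ) ≤ Fintype.card S := Nat.cast_nonneg _
  set M := (lap p).updateRow r (Pi.single r 1) with hM
  have hloss := det_arrowMat_sub_le r (B := rootRow r p) (D := d.updateRow r 0)
    (fun s t => by
      by_cases hs : s = r
      · subst hs; simp
      · simpa [hs] using hd0 s t)
    (fun s t => by
      by_cases hs : s = r
      · subst hs; simpa using rootRow_nonneg s h.nonneg s t
      · simpa [hs, rootRow] using hdp s t)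
  rw [rootRow_sub, ← treeWt_eq, ← treeWt_eq, arrowMat_rootRow, ← hM] at hloss
  have hterm : ∀ s, (M.updateRow s (∑ t, d.updateRow r 0 s t • arrowRow r s t)).det
      ≤ Fintype.card S * (e * Fintype.card S * treeWt r p) := by
    intro s
    by_cases hs : s = r
    · subst hs
      rw [Matrix.det_eq_zero_of_row_eq_zero s (fun j => by simp)]
      positivity
    · have h1 : (M.updateRow s (∑ t, d.updateRow r 0 s t • arrowRow r s t)).det
          = ∑ t, d s t * (M.adjugate s s - M.adjugate t s) := by
        rw [← Matrix.cramer_transpose_apply, map_sum, Finset.sum_apply]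
        refine Finset.sum_congr rfl fun t _ => ?_
        rw [map_smul, Pi.smul_apply, smul_eq_mul, arrowRow, if_neg hs, map_sub, Pi.sub_apply,
          Matrix.updateRow_ne hs, Matrix.cramer_transpose_apply, Matrix.cramer_transpose_apply,
          Matrix.adjugate_apply, Matrix.adjugate_apply]
      rw [h1]
      refine (Finset.sum_le_card_nsmul _ _ (e * Fintype.card S * treeWt r p)
        fun t _ => ?_).trans_eq (by rw [nsmul_eq_mul, Finset.card_univ])
      set A := M.adjugate s s - M.adjugate t s with hA
      rcases le_or_gt A 0 with hA0 | hA0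
      · exact (mul_nonpos_of_nonneg_of_nonpos (hd0 s t) hA0).trans (by positivity)
      · have h2 : A * z ≤ Fintype.card S * (μ s * treeWt r p) := h.adjugate_sub_le hz.le hs t
        have h3 := mul_le_mul (hde s t) h2 (mul_nonneg hA0.le hz.le) (mul_nonneg he hz.le)
        refine le_of_mul_le_mul_right ?_ (mul_pos (h.pos s) hz)
        linarith
  have hsum := Finset.sum_le_card_nsmul univ _ _ fun s _ => hterm s
  rw [nsmul_eq_mul, Finset.card_univ] at hsum
  have : e * (Fintype.card S : ℝ) ^ 3 * treeWt r p = Fintype.card S *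
    (Fintype.card S * (e * Fintype.card S * treeWt r p)) := by ring
  linarith

/-! ### Comparison of close transition matrices -/

theorem IsClose.treeWt_le {q qh : Matrix S S ℝ} {μ : S → ℝ} {z ε β : ℝ}
    (hclose : IsClose q qh μ z ε β) (h : HasCuts q μ z) (hz : 0 < z) (hqh : ∀ s t, 0 ≤ qh s t)
    (hε : 0 ≤ ε) (hβ0 : 0 ≤ β) (hβ1 : β ≤ 1) (hsmall : ε * (Fintype.card S : ℝ) ^ 3 ≤ 1)
    (r : S) : (1 - ε * (Fintype.card S : ℝ) ^ 3) * ((1 - β) ^ Fintype.card S * treeWt r qh)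
      ≤ treeWt r q := by
  let d : Matrix S S ℝ := fun s _ => ε * z / μ s
  have hd0 : ∀ s t, 0 ≤ d s t := fun s t => div_nonneg (mul_nonneg hε hz.le) (h.pos s).le
  have hμd : ∀ s t, μ s * d s t = ε * z := fun s t => by
    have := (h.pos s).ne'
    simp only [d]; field_simp
  have hadd : HasCuts (q + d) μ z := by
    refine ⟨fun s t => add_nonneg (h.nonneg s t) (hd0 s t), h.pos, fun u => ?_,
      fun C hC hC' => (h.cut C hC hC').trans ?_⟩
    · simp only [Matrix.add_apply, mul_add, Finset.sum_add_distrib, hμd]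
      rw [h.balanced]
    · refine Finset.sum_le_sum fun u _ => Finset.sum_le_sum fun w _ => ?_
      exact mul_le_mul_of_nonneg_left (le_add_of_nonneg_right (hd0 u w)) (h.pos u).le
  have h1 := hadd.treeWt_sub_ge hz hε hd0 (fun s t => le_add_of_nonneg_left (h.nonneg s t))
    (fun s t => (hμd s t).le) r
  rw [add_sub_cancel_right] at h1
  refine le_trans (mul_le_mul_of_nonneg_left ?_ (by linarith)) h1
  refine pow_mul_treeWt_le r (by linarith) (by linarith) hqh fun s t => ?_
  rw [Matrix.add_apply]
  have hq0 := h.nonneg s t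
  have hqh0 := hqh s t
  by_cases hbig : ε * z ≤ μ s * qh s t
  · have h2 := (abs_le.1 (hclose s t (Or.inr hbig))).2
    have h3 : qh s t ≤ (1 + β) * q s t := by linarith
    have h4 := mul_le_mul_of_nonneg_left h3 (sub_nonneg.2 hβ1)
    have h5 : (1 - β) * ((1 + β) * q s t) ≤ q s t := by nlinarith [mul_nonneg (sq_nonneg β) hq0]
    linarith [hd0 s t]
  · have h2 : qh s t ≤ d s t := by
      rw [le_div_iff₀ (h.pos s)]
      linarith
    have := mul_nonneg hβ0 hqh0
    linarith

theorem IsClose.le_treeWt {q qh : Matrix S S ℝ} {μ : S → ℝ} {z ε β : ℝ}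
    (hclose : IsClose q qh μ z ε β) (h : HasCuts q μ z) (hz : 0 < z) (hqh : ∀ s t, 0 ≤ qh s t)
    (hε : 0 ≤ ε) (hβ0 : 0 ≤ β) (hβ1 : β ≤ 1) (r : S) :
    (1 - β) ^ Fintype.card S * ((1 - ε * (Fintype.card S : ℝ) ^ 3) * treeWt r q)
      ≤ treeWt r qh := by
  classical
  let d : Matrix S S ℝ := fun s t => if ε * z ≤ μ s * q s t then 0 else q s t
  have hd : ∀ s t, 0 ≤ d s t ∧ d s t ≤ q s t ∧ μ s * d s t ≤ ε * z ∧
      (1 - β) * (q s t - d s t) ≤ qh s t := by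
    intro s t
    by_cases hbig : ε * z ≤ μ s * q s t
    · have h2 := (abs_le.1 (hclose s t (Or.inl hbig))).1
      simp only [d, if_pos hbig, mul_zero, sub_zero]
      exact ⟨le_rfl, h.nonneg s t, mul_nonneg hε hz.le, by linarith⟩
    · simp only [d, if_neg hbig, sub_self, mul_zero]
      exact ⟨h.nonneg s t, le_rfl, (not_le.1 hbig).le, hqh s t⟩
  have h1 := h.treeWt_sub_ge hz hε (fun s t => (hd s t).1) (fun s t => (hd s t).2.1)
    (fun s t => (hd s t).2.2.1) r
  refine (mul_le_mul_of_nonneg_left h1 (pow_nonneg (by linarith) _)).trans ?_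
  exact pow_mul_treeWt_le r (by linarith) (by linarith) (fun s t => sub_nonneg.2 (hd s t).2.1)
    fun s t => (hd s t).2.2.2

/-! ### Irreducible transition matrices -/

theorem IsTransition.pow_nonneg {q : Matrix S S ℝ} (hq : IsTransition q) (n : ℕ) (s t : S) :
    0 ≤ (q ^ n) s t := by
  induction n generalizing s t with
  | zero => by_cases h : s = t <;> simp [h]
  | succ n ih =>
    rw [pow_succ, Matrix.mul_apply]
    exact Finset.sum_nonneg fun u _ => mul_nonneg (ih s u) (hq.1 u t)

theorem IsStationary.pos {q : Matrix S S ℝ} {μ : S → ℝ} (hμ : IsStationary q μ)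
    (hq : IsTransition q) (hirr : IsIrreducible q) (t : S) : 0 < μ t := by
  obtain ⟨s, hs⟩ : ∃ s, 0 < μ s := by
    by_contra! hcon
    have := Finset.sum_nonpos fun s (_ : s ∈ univ) => hcon s
    rw [hμ.2.1] at this
    linarith
  have hpow : ∀ n t, ∑ s, μ s * (q ^ n) s t = μ t := by
    intro n
    induction n with
    | zero => intro t; simp [Matrix.one_apply]
    | succ n ih =>
      intro t
      simp_rw [pow_succ, Matrix.mul_apply, Finset.mul_sum]
      rw [Finset.sum_comm]
      simp_rw [← mul_assoc, ← Finset.sum_mul, ih]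
      exact hμ.2.2 t
  obtain ⟨n, -, hn⟩ := hirr s t
  rw [← hpow n t]
  exact Finset.sum_pos' (fun u _ => mul_nonneg (hμ.1 u) (hq.pow_nonneg n u t))
    ⟨s, mem_univ s, mul_pos hs hn⟩

theorem IsIrreducible.cut_pos {q : Matrix S S ℝ} {μ : S → ℝ} (hirr : IsIrreducible q)
    (hq : IsTransition q) (hμ : IsStationary q μ) {C : Finset S} (hC : C.Nonempty)
    (hC' : C ≠ univ) : 0 < ∑ s ∈ C, μ s * ∑ t ∈ Cᶜ, q s t := by
  have hterm : ∀ s ∈ C, 0 ≤ μ s * ∑ t ∈ Cᶜ, q s t := fun s _ =>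
    mul_nonneg (hμ.1 s) (Finset.sum_nonneg fun t _ => hq.1 s t)
  refine lt_of_le_of_ne (Finset.sum_nonneg hterm) fun h0 => ?_
  have hzero : ∀ s ∈ C, ∀ t ∉ C, q s t = 0 := by
    intro s hs t ht
    have h1 := (Finset.sum_eq_zero_iff_of_nonneg hterm).1 h0.symm s hs
    have h2 := (mul_eq_zero.1 h1).resolve_left (hμ.pos hq hirr s).ne'
    exact (Finset.sum_eq_zero_iff_of_nonneg fun t _ => hq.1 s t).1 h2 t (Finset.mem_compl.2 ht)
  have hpow : ∀ n, ∀ s ∈ C, ∀ t ∉ C, (q ^ n) s t = 0 := by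
    intro n
    induction n with
    | zero =>
      intro s hs t ht
      simp [show s ≠ t from fun h => ht (h ▸ hs)]
    | succ n ih =>
      intro s hs t ht
      rw [pow_succ, Matrix.mul_apply]
      refine Finset.sum_eq_zero fun u _ => ?_
      by_cases hu : u ∈ C
      · rw [hzero u hu t ht, mul_zero]
      · rw [ih s hs u hu, zero_mul]
  obtain ⟨s, hs⟩ := hC
  obtain ⟨t, ht⟩ : ∃ t, t ∉ C := by
    by_contra! h
    exact hC' (Finset.eq_univ_of_forall h)
  obtain ⟨n, -, hn⟩ := hirr s t
  exact hn.ne' (hpow n s hs t ht)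

theorem zeta_set_finite (q : Matrix S S ℝ) (μ : S → ℝ) :
    {x : ℝ | ∃ C : Finset S, C.Nonempty ∧ C ≠ univ ∧
      x = ∑ s ∈ C, μ s * ∑ t ∈ Cᶜ, q s t}.Finite := by
  refine (Set.finite_range fun C : Finset S => ∑ s ∈ C, μ s * ∑ t ∈ Cᶜ, q s t).subset ?_
  rintro x ⟨C, -, -, rfl⟩
  exact ⟨C, rfl⟩

theorem zeta_le (q : Matrix S S ℝ) (μ : S → ℝ) {C : Finset S} (hC : C.Nonempty)
    (hC' : C ≠ univ) : zeta q μ ≤ ∑ s ∈ C, μ s * ∑ t ∈ Cᶜ, q s t :=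
  csInf_le (zeta_set_finite q μ).bddBelow ⟨C, hC, hC', rfl⟩

theorem zeta_pos (hcard : 2 ≤ Fintype.card S) {q : Matrix S S ℝ} {μ : S → ℝ}
    (hq : IsTransition q) (hirr : IsIrreducible q) (hμ : IsStationary q μ) : 0 < zeta q μ := by
  have hne : {x : ℝ | ∃ C : Finset S, C.Nonempty ∧ C ≠ univ ∧
      x = ∑ s ∈ C, μ s * ∑ t ∈ Cᶜ, q s t}.Nonempty := by
    obtain ⟨s, t, hst⟩ := Fintype.exists_pair_of_one_lt_card hcard
    exact ⟨_, {s}, Finset.singleton_nonempty s,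
      fun h => hst (Finset.mem_singleton.1 (h ▸ mem_univ t)).symm, rfl⟩
  obtain ⟨C, hC, hC', h⟩ := hne.csInf_mem (zeta_set_finite q μ)
  rw [zeta, h]
  exact hirr.cut_pos hq hμ hC hC'

theorem IsStationary.sum_mul_lap {q : Matrix S S ℝ} {μ : S → ℝ} (hμ : IsStationary q μ)
    (hq : IsTransition q) (t : S) : ∑ s, μ s * lap q s t = 0 := by
  simp only [lap, Matrix.sub_apply, Matrix.diagonal_apply, mul_sub, Finset.sum_sub_distrib,
    mul_ite, mul_zero, Finset.sum_ite_eq', mem_univ, if_true, hq.2, mul_one, hμ.2.2, sub_self]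

/-- A stationary distribution is given by the normalized tree weights. -/
theorem IsStationary.mul_sum_treeWt {q : Matrix S S ℝ} {μ : S → ℝ} (hμ : IsStationary q μ)
    (hq : IsTransition q) (hpos : ∀ r, 0 < treeWt r q) (s : S) :
    μ s * ∑ r, treeWt r q = treeWt s q := by
  rw [Finset.mul_sum, Finset.sum_congr rfl fun r _ =>
    mul_treeWt_comm (hpos r).ne' (hμ.sum_mul_lap hq) s, ← Finset.sum_mul, hμ.2.1, one_mul]

theorem hasCuts_zeta {q : Matrix S S ℝ} {μ : S → ℝ} (hq : IsTransition q)
    (hirr : IsIrreducible q) (hμ : IsStationary q μ) : HasCuts q μ (zeta q μ) where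
  nonneg := hq.1
  pos := hμ.pos hq hirr
  balanced u := by rw [← Finset.mul_sum, hq.2, mul_one, hμ.2.2]
  cut C hC hC' := by
    simp_rw [← Finset.mul_sum]
    exact zeta_le q μ hC hC'

theorem card_le_Lconst {ι : Type*} [Fintype ι] (hcard : 2 ≤ Fintype.card ι) :
    Fintype.card ι ≤ Lconst ι := by
  have := Finset.single_le_sum (f := fun n => (Fintype.card ι).choose n * n ^ Fintype.card ι)
    (fun _ _ => Nat.zero_le _) (Finset.mem_Ico.2 ⟨le_rfl, hcard⟩ : 1 ∈ Ico 1 (Fintype.card ι))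
  simpa [Lconst] using this

/-- The outflow of a cut computed with the close matrix `q̂` and the weights `μ`. -/
theorem IsClose.cut_bounds {q qh : Matrix S S ℝ} {μ : S → ℝ} {z ε β : ℝ}
    (hclose : IsClose q qh μ z ε β) (h : HasCuts q μ z) (hz : 0 < z) (hqh : ∀ s t, 0 ≤ qh s t)
    (hε : 0 ≤ ε) (hβ0 : 0 ≤ β) (C : Finset S) (hC : C.Nonempty) (hC' : C ≠ univ) :
    (1 - β - ε * (Fintype.card S : ℝ) ^ 2) * (∑ s ∈ C, μ s * ∑ t ∈ Cᶜ, q s t)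
        ≤ ∑ s ∈ C, μ s * ∑ t ∈ Cᶜ, qh s t ∧
      ∑ s ∈ C, μ s * ∑ t ∈ Cᶜ, qh s t
        ≤ (1 + β + ε * (Fintype.card S : ℝ) ^ 2) * (∑ s ∈ C, μ s * ∑ t ∈ Cᶜ, q s t) := by
  have hpt : ∀ s t, (1 - β) * (μ s * q s t) - ε * z ≤ μ s * qh s t ∧
      μ s * qh s t ≤ (1 + β) * (μ s * q s t) + ε * z := by
    intro s t
    have hμs := h.pos s
    have hεz := mul_nonneg hε hz.le
    have hf := mul_nonneg hμs.le (h.nonneg s t)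
    have hfh := mul_nonneg hμs.le (hqh s t)
    by_cases hbig : ε * z ≤ μ s * q s t ∨ ε * z ≤ μ s * qh s t
    · have h2 := abs_le.1 (hclose s t hbig)
      have h3 := mul_le_mul_of_nonneg_left h2.1 hμs.le
      have h4 := mul_le_mul_of_nonneg_left h2.2 hμs.le
      constructor <;> linarith
    · rw [not_or, not_le, not_le] at hbig
      have := mul_nonneg hβ0 hf
      constructor <;> linarith [hbig.1, hbig.2]
  have hcut := h.cut C hC hC'
  simp only [← Finset.mul_sum] at hcut
  set F := ∑ s ∈ C, μ s * ∑ t ∈ Cᶜ, q s t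
  have hconst : ∑ s ∈ C, ∑ t ∈ Cᶜ, ε * z ≤ ε * (Fintype.card S : ℝ) ^ 2 * F := by
    simp only [Finset.sum_const, nsmul_eq_mul]
    have h1 : (C.card : ℝ) ≤ Fintype.card S := by exact_mod_cast Finset.card_le_univ C
    have h2 : (Cᶜ.card : ℝ) ≤ Fintype.card S := by exact_mod_cast Finset.card_le_univ _
    have h3 := mul_le_mul h1 h2 (Nat.cast_nonneg _) (Nat.cast_nonneg _)
    have h4 := mul_le_mul_of_nonneg_left hcut hε
    have h5 := mul_le_mul h3 h4 (mul_nonneg hε hz.le) (by positivity)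
    linarith
  have hlow := Finset.sum_le_sum fun s (_ : s ∈ C) =>
    Finset.sum_le_sum fun t (_ : t ∈ Cᶜ) => (hpt s t).1
  have hup := Finset.sum_le_sum fun s (_ : s ∈ C) =>
    Finset.sum_le_sum fun t (_ : t ∈ Cᶜ) => (hpt s t).2
  simp only [Finset.sum_sub_distrib, Finset.sum_add_distrib, ← Finset.mul_sum] at hlow hup hconst
  constructor <;> linarith

/-- the average lengths of visits to `C`,
`K_C = μ_C / Σ_{s∈C} μ_s q(C̄|s)` and `K̂_C = μ̂_C / Σ_{s∈C} μ̂_s q̂(C̄|s)`,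
satisfy `K_C/(2|S|²) ≤ K̂_C ≤ 2|S|²·K_C`. -/
theorem perturbed_visit_length_close
    (hcard : 2 ≤ Fintype.card S)
    (q qh : Matrix S S ℝ) (μ : S → ℝ) (β ε : ℝ)
    (hβ0 : 0 < β) (hβ1 : β < 1 / 2 ^ Fintype.card S)
    (hε0 : 0 < ε)
    (hε1 : ε < β * (1 - β) / ((Lconst S : ℝ) * (Fintype.card S : ℝ) ^ 4))
    (hq : IsTransition q) (hqirr : IsIrreducible q) (hμ : IsStationary q μ)
    (hqh : IsTransition qh)
    (hclose : IsClose q qh μ (zeta q μ) ε β) :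
    ∀ μh : S → ℝ, IsStationary qh μh →
      ∀ C : Finset S, C.Nonempty → C ≠ Finset.univ →
        ((∑ s ∈ C, μ s) / (∑ s ∈ C, μ s * ∑ t ∈ Cᶜ, q s t)) / (2 * (Fintype.card S : ℝ) ^ 2)
            ≤ (∑ s ∈ C, μh s) / (∑ s ∈ C, μh s * ∑ t ∈ Cᶜ, qh s t) ∧
          (∑ s ∈ C, μh s) / (∑ s ∈ C, μh s * ∑ t ∈ Cᶜ, qh s t)
            ≤ 2 * (Fintype.card S : ℝ) ^ 2 *
                ((∑ s ∈ C, μ s) / (∑ s ∈ C, μ s * ∑ t ∈ Cᶜ, q s t)) := by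
  intro μh hμh C hC hC'
  set N := Fintype.card S with hN
  have hN2 : (2 : ℝ) ≤ N := by exact_mod_cast hcard
  have h := hasCuts_zeta hq hqirr hμ
  have hz := zeta_pos hcard hq hqirr hμ
  have hβN : N * β ≤ 1 / 2 := by
    have h1 : (2 : ℝ) * N ≤ 2 ^ N := by
      obtain ⟨m, hm⟩ : ∃ m, N = m + 1 := ⟨N - 1, by omega⟩
      have : m + 1 ≤ 2 ^ m := Nat.lt_two_pow_self
      rw [hm, pow_succ]
      have h2 : ((m + 1 : ℕ) : ℝ) ≤ 2 ^ m := by exact_mod_cast this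
      linarith
    rw [lt_div_iff₀ (by positivity)] at hβ1
    have := mul_le_mul_of_nonneg_left h1 hβ0.le
    linarith
  have hβ4 : β ≤ 1 / 4 := by nlinarith
  have hεN : ε * (N : ℝ) ^ 3 ≤ 1 / 16 := by
    have hL : (2 : ℝ) ≤ Lconst S := by exact_mod_cast hcard.trans (card_le_Lconst hcard)
    rw [lt_div_iff₀ (by positivity)] at hε1
    have h1 : (2 : ℝ) * 2 ≤ Lconst S * N := mul_le_mul hL hN2 (by norm_num) (by positivity)
    have h2 := mul_le_mul_of_nonneg_right h1 (by positivity : 0 ≤ ε * (N : ℝ) ^ 3)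
    have h3 : β * (1 - β) ≤ 1 / 4 := by nlinarith
    linarith
  have hεN2 : ε * (N : ℝ) ^ 2 ≤ 1 / 16 := by
    refine le_trans (mul_le_mul_of_nonneg_left ?_ hε0.le) hεN
    exact pow_le_pow_right₀ (by linarith) (by norm_num)
  have hpow : 1 / 2 ≤ (1 - β) ^ N := by
    have := one_add_mul_le_pow (by linarith : -2 ≤ -β) N
    rw [← sub_eq_add_neg] at this
    linarith
  have hWpos := h.treeWt_pos hz
  have hlow : ∀ r, 15 / 32 * treeWt r q ≤ treeWt r qh := by
    intro r
    refine le_trans ?_ (hclose.le_treeWt h hz hqh.1 hε0.le hβ0.le (by linarith) r)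
    rw [← mul_assoc]
    refine mul_le_mul_of_nonneg_right ?_ (hWpos r).le
    have := mul_le_mul hpow (by linarith : 15 / 16 ≤ 1 - ε * (N : ℝ) ^ 3) (by norm_num)
      (by linarith)
    linarith
  have hup : ∀ r, 15 / 32 * treeWt r qh ≤ treeWt r q := by
    intro r
    refine le_trans ?_ (hclose.treeWt_le h hz hqh.1 hε0.le hβ0.le (by linarith)
      (by linarith) r)
    rw [← mul_assoc]
    refine mul_le_mul_of_nonneg_right ?_ (treeWt_nonneg r hqh.1)
    have := mul_le_mul hpow (by linarith : 15 / 16 ≤ 1 - ε * (N : ℝ) ^ 3) (by norm_num)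
      (by linarith)
    linarith
  have hWhpos : ∀ r, 0 < treeWt r qh := fun r => by linarith [hlow r, hWpos r]
  have hne : (univ : Finset S).Nonempty := hC.mono (subset_univ C)
  set Z := ∑ r, treeWt r q with hZ
  set Zh := ∑ r, treeWt r qh with hZh
  have hZ0 : 0 < Z := Finset.sum_pos (fun r _ => hWpos r) hne
  have hZh0 : 0 < Zh := Finset.sum_pos (fun r _ => hWhpos r) hne
  have hμW := hμ.mul_sum_treeWt hq hWpos
  have hμhW := hμh.mul_sum_treeWt hqh hWhpos
  have hμlow : ∀ s, 15 / 32 * Z * μ s ≤ Zh * μh s := fun s => by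
    have := hlow s
    rw [← hμW, ← hμhW] at this
    linarith
  have hμup : ∀ s, 15 / 32 * Zh * μh s ≤ Z * μ s := fun s => by
    have := hup s
    rw [← hμW, ← hμhW] at this
    linarith
  have hmul : ∀ {a b : ℝ} {x y : S → ℝ} (w : S → ℝ), (∀ s, 0 ≤ w s) →
      (∀ s, a * x s ≤ b * y s) → a * ∑ s ∈ C, x s * w s ≤ b * ∑ s ∈ C, y s * w s := by
    intro a b x y w hw hxy
    simp_rw [Finset.mul_sum, ← mul_assoc]
    exact Finset.sum_le_sum fun s _ => mul_le_mul_of_nonneg_right (hxy s) (hw s)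
  have hout : ∀ s, 0 ≤ ∑ t ∈ Cᶜ, qh s t := fun s => Finset.sum_nonneg fun t _ => hqh.1 s t
  have hm1 := hmul (fun _ => 1) (fun _ => zero_le_one) hμlow
  have hm2 := hmul (fun _ => 1) (fun _ => zero_le_one) hμup
  simp only [mul_one] at hm1 hm2
  have hf1 := hmul _ hout hμlow
  have hf2 := hmul _ hout hμup
  obtain ⟨hc1, hc2⟩ := hclose.cut_bounds h hz hqh.1 hε0.le hβ0.le C hC hC'
  have hF0 := hqirr.cut_pos hq hμ hC hC'
  have hm0 : 0 < ∑ s ∈ C, μ s := Finset.sum_pos (fun s _ => h.pos s) hC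
  set F := ∑ s ∈ C, μ s * ∑ t ∈ Cᶜ, q s t with hF
  set G := ∑ s ∈ C, μ s * ∑ t ∈ Cᶜ, qh s t with hG
  set Fh := ∑ s ∈ C, μh s * ∑ t ∈ Cᶜ, qh s t with hFh
  set m := ∑ s ∈ C, μ s with hm
  set mh := ∑ s ∈ C, μh s with hmh
  have hg1 : 11 / 16 * F ≤ G :=
    (mul_le_mul_of_nonneg_right (by linarith) hF0.le).trans hc1
  have hg2 : G ≤ 21 / 16 * F :=
    hc2.trans (mul_le_mul_of_nonneg_right (by linarith) hF0.le)
  set k := Z / Zh with hk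
  have hk0 : 0 < k := div_pos hZ0 hZh0
  have hkZ : Z = k * Zh := by rw [hk]; field_simp
  rw [hkZ] at hm1 hm2 hf1 hf2
  replace hm1 : 15 / 32 * k * m ≤ mh := le_of_mul_le_mul_right (by linarith) hZh0
  replace hm2 : 15 / 32 * mh ≤ k * m := le_of_mul_le_mul_right (by linarith) hZh0
  replace hf1 : 15 / 32 * k * G ≤ Fh := le_of_mul_le_mul_right (by linarith) hZh0
  replace hf2 : 15 / 32 * Fh ≤ k * G := le_of_mul_le_mul_right (by linarith) hZh0
  have hfl : 15 / 32 * (11 / 16) * (k * F) ≤ Fh := by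
    have := mul_le_mul_of_nonneg_left hg1 hk0.le
    linarith
  have hfu : Fh ≤ 32 / 15 * (21 / 16) * (k * F) := by
    have := mul_le_mul_of_nonneg_left hg2 hk0.le
    linarith
  have hkF : 0 < k * F := mul_pos hk0 hF0
  have hkm : 0 < k * m := mul_pos hk0 hm0
  have hFh0 : 0 < Fh := by linarith
  have hK : m / F = (k * m) / (k * F) := by rw [mul_div_mul_left _ _ hk0.ne']
  have hN8 : (8 : ℝ) ≤ 2 * (N : ℝ) ^ 2 := by nlinarith
  have hKpos : 0 < (k * m) / (k * F) := div_pos hkm hkF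
  rw [hK]
  constructor
  · refine (div_le_div_of_nonneg_left hKpos.le (by norm_num) hN8).trans ?_
    rw [div_div, div_le_div_iff₀ (by positivity) hFh0]
    have h1 := mul_le_mul_of_nonneg_left hfu hkm.le
    have h2 := mul_le_mul_of_nonneg_right hm1 hkF.le
    have h3 := mul_pos hkm hkF
    linarith
  · refine le_trans ?_ (mul_le_mul_of_nonneg_right hN8 hKpos.le)
    rw [← mul_div_assoc, div_le_div_iff₀ hFh0 hkF]
    have h1 := mul_le_mul_of_nonneg_left hfl hkm.le
    have h2 := mul_le_mul_of_nonneg_right hm2 hkF.le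
    have h3 := mul_pos hkm hkF
    linarith

end PerturbedMC
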